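/- The power series F(t) = Σ_{k≥0} C(2k,k)² t^{2k} is transcendental over the field of rational functions ℚ(t); consequently the Hilbert series Σ_{k≥0} C_k² t^{2k} of the invariant ring of SL(2)×SL(2) acting on tensor powers of ℂ²⊗ℂ² is not algebraic, since its Hadamard product with the rational series Σ_{k≥0} (k+1)² t^{2k} equals F(t) and Hadamard products of algebraic univariate series with rational series are algebraic. -/

import Mathlib

set_option synthInstance.maxHeartbeats 1000000
set_option maxHeartbeats 1000000

open scoped TensorProduct

/-- A power series `f ∈ ℚ[[t]]` is algebraic (over `ℚ(t)`) if it satisfies a nonzero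
polynomial equation with polynomial coefficients. -/
def IsAlgebraicPS (f : PowerSeries ℚ) : Prop :=
  ∃ P : Polynomial (Polynomial ℚ), P ≠ 0 ∧
    P.eval₂ (Polynomial.coeToPowerSeries.ringHom) f = 0

/-- The space of `SL(2)×SL(2)`-invariants in the `n`-th tensor power of
`ℂ² ⊗ ℂ²`. -/
noncomputable def sl2sl2Invariants (n : ℕ) :
    Submodule ℂ (PiTensorProduct ℂ fun _ : Fin n => ((Fin 2 → ℂ) ⊗[ℂ] (Fin 2 → ℂ))) :=
  ⨅ g : Matrix.SpecialLinearGroup (Fin 2) ℂ, ⨅ h : Matrix.SpecialLinearGroup (Fin 2) ℂ,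
    LinearMap.eqLocus
      (PiTensorProduct.map fun _ : Fin n =>
        TensorProduct.map (Matrix.toLin' (g : Matrix (Fin 2) (Fin 2) ℂ))
          (Matrix.toLin' (h : Matrix (Fin 2) (Fin 2) ℂ)))
      LinearMap.id

abbrev SL2SL2Amb (n : ℕ) :=
  PiTensorProduct ℂ fun _ : Fin n => ((Fin 2 → ℂ) ⊗[ℂ] (Fin 2 → ℂ))

noncomputable instance (n : ℕ) (p : Submodule ℂ (SL2SL2Amb n)) : AddCommGroup ↥p :=
  @Submodule.addCommGroup ℂ (SL2SL2Amb n) _ _ _ p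

noncomputable instance (n : ℕ) (p : Submodule ℂ (SL2SL2Amb n)) : Module ℂ ↥p :=
  @Submodule.module ℂ (SL2SL2Amb n) _ _ _ p

open Polynomial in
theorem simple_factor {p : ℕ} [Fact p.Prime] (hp : 2 < p) (A : (ZMod p)[X])
    (hdeg : A.natDegree < p) (h0 : A.coeff 0 ≠ 0)
    (ode : X * (1 - 16 * X ^ 2) * derivative (derivative A) + (1 - 48 * X ^ 2) * derivative A
      - 16 * X * A = 0) (q : (ZMod p)[X]) (hq : Irreducible q) (hqA : q ∣ A) : ¬ q ^ 2 ∣ A := by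
  intro hq2
  have hA : A ≠ 0 := by rintro rfl; simp at h0
  have hprime : Prime q := hq.prime
  have hsep : IsCoprime q (derivative q) := (PerfectField.separable_of_irreducible hq)
  have hnd : ¬ q ∣ derivative q := by
    intro h
    exact hq.not_isUnit (hsep.isUnit_of_dvd' dvd_rfl h)
  obtain ⟨m, B, hB, hAB⟩ := WfDvdMonoid.max_power_factor hA hq
  have hm : 2 ≤ m := by
    by_contra hlt
    rw [hAB] at hq2
    have : m = 0 ∨ m = 1 := by omega
    rcases this with rfl | rfl
    · exact hB ((dvd_pow_self q two_ne_zero).trans (by simpa using hq2))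
    · rw [pow_two, pow_one] at hq2
      exact hB ((mul_dvd_mul_iff_left hq.ne_zero).1 hq2)
  obtain ⟨k, rfl⟩ := Nat.exists_eq_add_of_le' hm
  have hB0 : B ≠ 0 := by rintro rfl; simp at hB
  have hmp : k + 2 < p := by
    rw [hAB, natDegree_mul (pow_ne_zero _ hq.ne_zero) hB0, natDegree_pow] at hdeg
    have : 0 < q.natDegree := hq.natDegree_pos
    nlinarith
  have hc : ∀ j : ℕ, 0 < j → j < p → ¬ q ∣ (j : (ZMod p)[X]) := by
    intro j hj hjp hd
    have : (j : ZMod p) ≠ 0 := by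
      rw [Ne, ZMod.natCast_eq_zero_iff]
      exact Nat.not_dvd_of_pos_of_lt hj hjp
    have hu : IsUnit (j : (ZMod p)[X]) := by
      rw [← C_eq_natCast]
      exact isUnit_C.2 (isUnit_iff_ne_zero.2 this)
    exact hq.not_isUnit (isUnit_of_dvd_unit hd hu)
  have hX : ¬ q ∣ X := by
    intro h
    have hass : Associated q X := hq.associated_of_dvd irreducible_X h
    exact h0 (X_dvd_iff.1 (hass.symm.dvd.trans hqA))
  have d1 : derivative A = q ^ (k + 1) * (((k + 2 : ℕ) : (ZMod p)[X]) * derivative q * B + q * derivative B) := by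
    rw [hAB]
    simp only [derivative_mul, derivative_pow]
    simp [C_ofNat]
    ring
  have d2 : derivative (derivative A) = q ^ k * (((k + 2 : ℕ) : (ZMod p)[X]) * ((k + 1 : ℕ) : (ZMod p)[X]) * derivative q ^ 2 * B
      + q * (2 * ((k + 2 : ℕ) : (ZMod p)[X]) * derivative q * derivative B + ((k + 2 : ℕ) : (ZMod p)[X]) * derivative (derivative q) * B + q * derivative (derivative B))) := by
    rw [d1]
    simp only [derivative_mul, derivative_pow, derivative_add, derivative_natCast]
    simp
    ring
  have hw : q ∣ 1 - 16 * X ^ 2 := by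
    by_contra hw
    rw [d2, d1, hAB] at ode
    have e : q ^ k * (X * (1 - 16 * X ^ 2) * (((k + 2 : ℕ) : (ZMod p)[X]) * ((k + 1 : ℕ) : (ZMod p)[X]) * derivative q ^ 2 * B)) =
       q ^ k * (q * (-(X * (1 - 16 * X ^ 2) * (2 * ((k + 2 : ℕ) : (ZMod p)[X]) * derivative q * derivative B + ((k + 2 : ℕ) : (ZMod p)[X]) * derivative (derivative q) * B + q * derivative (derivative B)))
         - (1 - 48 * X ^ 2) * (((k + 2 : ℕ) : (ZMod p)[X]) * derivative q * B + q * derivative B) + 16 * X * q * B)) := by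
      linear_combination ode
    have e2 := mul_left_cancel₀ (pow_ne_zero k hq.ne_zero) e
    have := Dvd.intro _ e2.symm
    have c1 := hc (k+2) (by omega) hmp
    have c2 := hc (k+1) (by omega) (by omega)
    simp only [hprime.dvd_mul, pow_two] at this
    simp only [← pow_two] at this
    tauto
  obtain ⟨s, hs⟩ := hw
  have hs' := congrArg derivative hs
  have hs2 : -32 * X = derivative q * s + q * derivative s := by
    rw [← derivative_mul, ← hs]
    simp
    ring
  rw [d2, d1, hAB, hs] at ode
  have e : q ^ (k+1) * (((k + 2 : ℕ) : (ZMod p)[X]) * derivative q * B * (X * s * ((k + 1 : ℕ) : (ZMod p)[X]) * derivative q + 1 - 48 * X ^ 2)) =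
      q ^ (k+1) * (q * (-(X * s * (2 * ((k + 2 : ℕ) : (ZMod p)[X]) * derivative q * derivative B + ((k + 2 : ℕ) : (ZMod p)[X]) * derivative (derivative q) * B + q * derivative (derivative B)))
         - (1 - 48 * X ^ 2) * (derivative B) + 16 * X * B)) := by
      linear_combination ode
  have e2 := mul_left_cancel₀ (pow_ne_zero (k+1) hq.ne_zero) e
  have e3 := Dvd.intro _ e2.symm
  have c1 := hc (k+2) (by omega) hmp
  have e4 : q ∣ X * s * ((k + 1 : ℕ) : (ZMod p)[X]) * derivative q + 1 - 48 * X ^ 2 := by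
    simp only [hprime.dvd_mul] at e3
    tauto
  have e5 : q ∣ ((2 : ℕ) : (ZMod p)[X]) * ((k + 2 : ℕ) : (ZMod p)[X]) := by
    obtain ⟨r, hr⟩ := e4
    refine ⟨-r + (2 * ((k + 1 : ℕ) : (ZMod p)[X]) + 3) * s - ((k + 1 : ℕ) : (ZMod p)[X]) * X * derivative s, ?_⟩
    push_cast at hr ⊢
    linear_combination -(k+1)*X*hs2 - hr + (2 * (k+1) + 3) * hs
  rcases hprime.dvd_or_dvd e5 with h | h
  · exact hc 2 (by omega) hp h
  · exact c1 h

def bb (m : ℕ) : ℕ := if m % 2 = 0 then Nat.centralBinom (m / 2) else 0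

theorem bb_rec (m : ℕ) : (m + 2) * bb (m + 2) = 4 * (m + 1) * bb m := by
  unfold bb
  by_cases h : m % 2 = 0
  · obtain ⟨k, rfl⟩ : ∃ k, m = 2 * k := ⟨m / 2, by omega⟩
    have h1 : (2 * k + 2) / 2 = k + 1 := by omega
    have h2 : (2 * k) / 2 = k := by omega
    rw [if_pos (by omega), if_pos h, h1, h2]
    have := Nat.succ_mul_centralBinom_succ k
    linarith
  · rw [if_neg (by omega), if_neg h]; simp

theorem bb_lucas {p : ℕ} [hpf : Fact p.Prime] (hp : 2 < p) (i j : ℕ) (hi : i < p) :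
    (bb (i + p * j) : ZMod p) = bb i * bb j := by
  have hodd : p % 2 = 1 := hpf.out.mod_two_eq_one_iff_ne_two.2 (by omega)
  have luc : ∀ n k : ℕ, (Nat.choose n k : ZMod p) =
      Nat.choose (n % p) (k % p) * Nat.choose (n / p) (k / p) := by
    intro n k
    have := (ZMod.natCast_eq_natCast_iff _ _ _).2
      (Choose.choose_modEq_choose_mod_mul_choose_div_nat (n := n) (k := k) (p := p))
    simpa using this
  have hpar : (i + p * j) % 2 = (i + j) % 2 := by
    rw [Nat.add_mod, Nat.mul_mod, hodd]; simp [Nat.add_mod]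
  unfold bb
  rw [hpar]
  by_cases hj : j % 2 = 0
  · obtain ⟨b, rfl⟩ : ∃ k, j = 2 * k := ⟨j / 2, by omega⟩
    by_cases hi2 : i % 2 = 0
    · obtain ⟨a, rfl⟩ : ∃ k, i = 2 * k := ⟨i / 2, by omega⟩
      have h1 : (2 * a + p * (2 * b)) / 2 = a + p * b := by
        rw [show 2 * a + p * (2 * b) = 2 * (a + p * b) by ring]; omega
      have h2 : (2 * a) / 2 = a := by omega
      have h3 : (2 * b) / 2 = b := by omega
      rw [if_pos (by omega), if_pos (by omega), if_pos (by omega), h1, h2, h3]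
      simp only [Nat.centralBinom]
      rw [luc, show 2 * (a + p * b) = 2 * a + p * (2 * b) by ring]
      rw [Nat.add_mul_mod_self_left, Nat.add_mul_mod_self_left, Nat.mod_eq_of_lt hi,
        Nat.mod_eq_of_lt (by omega), Nat.add_mul_div_left _ _ (by omega),
        Nat.add_mul_div_left _ _ (by omega), Nat.div_eq_of_lt hi, Nat.div_eq_of_lt (by omega)]
      simp
    · rw [if_neg (by omega), if_neg (by omega)]; simp
  · by_cases hi2 : i % 2 = 0
    · rw [if_neg (by omega), if_neg hj]; simp
    · rw [if_pos (by omega), if_neg hj]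
      obtain ⟨b, rfl⟩ : ∃ k, j = 2 * k + 1 := ⟨j / 2, by omega⟩
      obtain ⟨a, ha⟩ : ∃ a, i + p = 2 * a := ⟨(i+p) / 2, by omega⟩
      have h1 : (i + p * (2 * b + 1)) / 2 = a + p * b := by
        rw [show i + p * (2 * b + 1) = (i + p) + 2 * (p * b) by ring, ha]; omega
      rw [h1]
      simp only [Nat.centralBinom]
      rw [luc, show 2 * (a + p * b) = i + p * (2 * b + 1) by linarith]
      rw [Nat.add_mul_mod_self_left, Nat.add_mul_mod_self_left, Nat.mod_eq_of_lt hi,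
        Nat.mod_eq_of_lt (by omega), Nat.choose_eq_zero_of_lt (n := i) (k := a) (by omega)]
      simp

open Polynomial in
noncomputable def AA (p : ℕ) : (ZMod p)[X] := ∑ i ∈ Finset.range p, C ((bb i : ZMod p) ^ 2) * X ^ i

open Polynomial in
theorem AA_coeff (p m : ℕ) : (AA p).coeff m = if m < p then (bb m : ZMod p) ^ 2 else 0 := by
  simp only [AA, finsetSum_coeff, coeff_C_mul, coeff_X_pow]
  simp

open Polynomial in
theorem AA_ode {p : ℕ} [hpf : Fact p.Prime] (hp : 2 < p) :
    X * (1 - 16 * X ^ 2) * derivative (derivative (AA p)) + (1 - 48 * X ^ 2) * derivative (AA p)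
      - 16 * X * AA p = 0 := by
  have hodd : p % 2 = 1 := hpf.out.mod_two_eq_one_iff_ne_two.2 (by omega)
  have hrec : ∀ m : ℕ, ((m : ZMod p) + 2) ^ 2 * (AA p).coeff (m + 2) = 16 * (m + 1) ^ 2 * (AA p).coeff m := by
    intro m
    have h := congrArg (Nat.cast : ℕ → ZMod p) (bb_rec m)
    push_cast at h
    rw [AA_coeff, AA_coeff]
    by_cases h1 : m + 2 < p
    · rw [if_pos h1, if_pos (by omega)]
      linear_combination (((m : ZMod p) + 2) * bb (m+2) + 4 * (m + 1) * bb m) * h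
    · rw [if_neg h1]
      by_cases h2 : m < p
      · rw [if_pos h2]
        have : m + 2 = p ∨ m + 1 = p := by omega
        rcases this with h3 | h3
        · have : bb m = 0 := by unfold bb; rw [if_neg (by omega)]
          simp [this]
        · have : (m : ZMod p) + 1 = 0 := by
            have : ((m + 1 : ℕ) : ZMod p) = 0 := by rw [h3]; simp
            simpa using this
          simp [this]
      · rw [if_neg h2]; simp
  have e : X * (1 - 16 * X ^ 2) * derivative (derivative (AA p)) + (1 - 48 * X ^ 2) * derivative (AA p)
      - 16 * X * AA p = X * derivative (derivative (AA p)) + derivative (AA p)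
       - C 16 * (X * (X * (X * derivative (derivative (AA p))) + C 3 * (X * derivative (AA p)) + AA p)) := by
    simp only [C_ofNat]
    ring
  rw [e]
  ext m
  rcases m with _ | m
  · simp [coeff_derivative, AA_coeff]
    rintro -
    simp [bb]
  · have hx : ∀ (Q : (ZMod p)[X]) , (X * Q).coeff m = if m = 0 then 0 else Q.coeff (m - 1) := by
      intro Q; rcases m with _ | m <;> simp
    simp only [coeff_sub, coeff_add, coeff_C_mul, coeff_X_mul, coeff_derivative, coeff_zero]
    have r := hrec m
    rcases m with _ | _ | m
    · simp [coeff_derivative] at r ⊢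
      linear_combination r
    · simp [coeff_derivative] at r ⊢
      linear_combination r
    · simp [coeff_derivative] at r ⊢
      linear_combination r

open Polynomial in
theorem AA_key {p : ℕ} [hpf : Fact p.Prime] (hp : 2 < p) :
    let f : PowerSeries (ZMod p) := PowerSeries.mk fun m => (bb m : ZMod p) ^ 2
    f ^ (p - 1) * (AA p : PowerSeries (ZMod p)) = 1 := by
  intro f
  have hpn : p ≠ 0 := by omega
  have hfrob : f ^ p = PowerSeries.expand p hpn f := by
    have := MvPowerSeries.map_frobenius_expand (R := ZMod p) (σ := Unit) p hpn (f := f)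
    rw [← this]
    rw [ZMod.frobenius_zmod]
    exact congrFun (congrArg _ (MvPowerSeries.map_id)) _
  have hf0 : f ≠ 0 := by
    intro h
    have := congrArg (PowerSeries.coeff 0) h
    simp [f, bb] at this
  have key : f = (AA p : PowerSeries (ZMod p)) * f ^ p := by
    rw [hfrob]
    ext m
    rw [PowerSeries.coeff_mul]
    have hm : m = m % p + p * (m / p) := (Nat.mod_add_div m p).symm
    have hlt := Nat.mod_lt m hpf.out.pos
    rw [Finset.sum_eq_single (m % p, p * (m / p))]
    · rw [PowerSeries.coeff_expand_mul, Polynomial.coeff_coe, AA_coeff, if_pos hlt]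
      simp only [f, PowerSeries.coeff_mk]
      conv_lhs => rw [hm, bb_lucas hp _ _ hlt]
      ring
    · rintro ⟨a, b⟩ hab hne
      rw [Finset.HasAntidiagonal.mem_antidiagonal] at hab
      simp only at hab ⊢
      rw [Polynomial.coeff_coe, AA_coeff]
      by_cases ha : a < p
      · by_cases hb : p ∣ b
        · exfalso
          obtain ⟨c, rfl⟩ := hb
          apply hne
          have h1 : m % p = a := by
            rw [← hab, Nat.add_mul_mod_self_left, Nat.mod_eq_of_lt ha]
          have h2 : m / p = c := by
            rw [← hab, Nat.add_mul_div_left _ _ hpf.out.pos, Nat.div_eq_of_lt ha, zero_add]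
          rw [h1, h2]
        · rw [PowerSeries.coeff_expand_of_not_dvd _ _ _ hb, mul_zero]
      · rw [if_neg ha, zero_mul]
    · intro h
      exact absurd (Finset.HasAntidiagonal.mem_antidiagonal.2 hm.symm) h
  apply mul_right_cancel₀ hf0
  rw [one_mul]
  conv_rhs => rw [key]
  obtain ⟨k, rfl⟩ : ∃ k, p = k + 1 := ⟨p - 1, by omega⟩
  simp only [Nat.add_sub_cancel, pow_succ]
  ring

open Polynomial in
theorem degree_bound {p : ℕ} [hpf : Fact p.Prime] (hp : 2 < p) (P : (ZMod p)[X][X]) (hP : P ≠ 0)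
    (h : P.eval₂ (Polynomial.coeToPowerSeries.ringHom)
      (PowerSeries.mk fun m => (bb m : ZMod p) ^ 2) = 0) : p - 1 ≤ P.natDegree := by
  have key := AA_key (p := p) hp
  simp only at key
  set f : PowerSeries (ZMod p) := PowerSeries.mk fun m => (bb m : ZMod p) ^ 2 with hf
  obtain ⟨g, hg⟩ : ∃ g, f * g = 1 := by
    refine ⟨f ^ (p - 2) * (AA p : PowerSeries (ZMod p)), ?_⟩
    rw [← key, ← mul_assoc, ← pow_succ', show p - 2 + 1 = p - 1 by omega]
  have hgA : g ^ (p - 1) = (AA p : PowerSeries (ZMod p)) := by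
    have : f ^ (p - 1) * g ^ (p - 1) = 1 := by rw [← mul_pow, hg, one_pow]
    calc g ^ (p - 1) = (f ^ (p - 1) * (AA p : PowerSeries (ZMod p))) * g ^ (p - 1) := by
          rw [key, one_mul]
      _ = (f ^ (p - 1) * g ^ (p - 1)) * (AA p : PowerSeries (ZMod p)) := by ring
      _ = _ := by rw [this, one_mul]
  have hA0 : (AA p).coeff 0 = 1 := by
    rw [AA_coeff, if_pos (by omega)]; simp [bb]
  have hA2 : (AA p).coeff 2 = 4 := by
    rw [AA_coeff, if_pos hp]; simp [bb, Nat.centralBinom]; norm_num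
  have h4 : (4 : ZMod p) ≠ 0 := by
    have : ((2 : ℕ) : ZMod p) ≠ 0 := by
      rw [Ne, ZMod.natCast_eq_zero_iff]
      exact Nat.not_dvd_of_pos_of_lt (by omega) hp
    have h5 := pow_ne_zero 2 this
    push_cast at h5
    intro h6
    apply h5
    rw [← h6]; norm_num
  have hdeg : (AA p).natDegree < p := by
    rw [Nat.lt_iff_le_pred hpf.out.pos]
    rw [natDegree_le_iff_coeff_eq_zero]
    intro N hN
    rw [AA_coeff, if_neg (by omega)]
  have hnu : ¬ IsUnit (AA p) := by
    intro hu
    have := natDegree_eq_zero_of_isUnit hu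
    have h2 := coeff_eq_zero_of_natDegree_lt (p := AA p) (n := 2) (by omega)
    rw [hA2] at h2
    exact h4 h2
  obtain ⟨q, hq, hqA⟩ := WfDvdMonoid.exists_irreducible_factor hnu (by
    intro h; rw [h] at hA0; simp at hA0)
  have hq2 := simple_factor hp (AA p) hdeg (by rw [hA0]; exact one_ne_zero) (AA_ode hp) q hq hqA
  have hmon : (X ^ (p - 1) - C (AA p) : (ZMod p)[X][X]).Monic :=
    monic_X_pow_sub_C _ (by omega)
  have hnat : (X ^ (p - 1) - C (AA p) : (ZMod p)[X][X]).natDegree = p - 1 :=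
    natDegree_X_pow_sub_C
  have hqp : (Ideal.span {q}).IsPrime := (Ideal.span_singleton_prime hq.ne_zero).2 hq.prime
  have hirr : Irreducible (X ^ (p - 1) - C (AA p) : (ZMod p)[X][X]) := by
    refine Polynomial.IsEisensteinAt.irreducible (𝓟 := Ideal.span {q})
      (hmon.isEisensteinAt_of_mem_of_notMem hqp.ne_top ?_ ?_) hqp hmon.isPrimitive
      (by rw [hnat]; omega)
    · intro n hn
      rw [hnat] at hn
      rw [coeff_sub, coeff_X_pow, if_neg (by omega), coeff_C, zero_sub]
      split_ifs
      · rw [neg_mem_iff]; exact Ideal.mem_span_singleton.2 hqA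
      · simp
    · rw [coeff_sub, coeff_X_pow, if_neg (by omega), coeff_C, if_pos rfl, zero_sub, neg_mem_iff,
        Ideal.span_singleton_pow, Ideal.mem_span_singleton]
      exact hq2
  have halg : (algebraMap (ZMod p)[X] (PowerSeries (ZMod p))) = Polynomial.coeToPowerSeries.ringHom := by
    ext x <;> simp [PowerSeries.algebraMap_apply']
  have hroot : aeval g (X ^ (p - 1) - C (AA p) : (ZMod p)[X][X]) = 0 := by
    rw [map_sub, map_pow, aeval_X, aeval_C, hgA, halg]
    simp
  have hint : IsIntegral (ZMod p)[X] g := ⟨_, hmon, hroot⟩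
  have : FaithfulSMul (ZMod p)[X] (PowerSeries (ZMod p)) := by
    rw [faithfulSMul_iff_algebraMap_injective, halg]
    exact Polynomial.coe_injective _
  have : Module.IsTorsionFree (ZMod p)[X] (PowerSeries (ZMod p)) := inferInstance
  have hdvd : minpoly (ZMod p)[X] g ∣ X ^ (p - 1) - C (AA p) :=
    minpoly.isIntegrallyClosed_dvd hint hroot
  have hass := (minpoly.prime_of_isIntegrallyClosed hint).irreducible.associated_of_dvd hirr hdvd
  have heq : minpoly (ZMod p)[X] g = X ^ (p - 1) - C (AA p) :=
    eq_of_monic_of_associated (minpoly.monic hint) hmon hass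
  have hrev : aeval g P.reverse = 0 := by
    rw [aeval_def, halg]
    let _ : Invertible f := ⟨g, by rw [mul_comm, hg], hg⟩
    have := (eval₂_reverse_eq_zero_iff (Polynomial.coeToPowerSeries.ringHom) f P).2 h
    exact this
  have hle := minpoly.IsIntegrallyClosed.degree_le_of_ne_zero (R := (ZMod p)[X]) (s := g)
    (by simpa using hP) hrev
  have h1 := natDegree_le_natDegree hle
  rw [heq, hnat] at h1
  exact h1.trans (reverse_natDegree_le P)

open Polynomial in
theorem clear_denominators (P : ℚ[X][X]) (hP : P ≠ 0) (f : PowerSeries ℤ)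
    (h : P.eval₂ (Polynomial.coeToPowerSeries.ringHom) (PowerSeries.map (Int.castRingHom ℚ) f) = 0) :
    ∃ Q : ℤ[X][X], Q ≠ 0 ∧ Q.eval₂ (Polynomial.coeToPowerSeries.ringHom) f = 0 := by
  letI : Algebra ℤ[X] ℚ[X] := Polynomial.algebra ℤ ℚ
  let M := (nonZeroDivisors ℤ).map (C : ℤ →+* ℤ[X])
  have : IsLocalization M ℚ[X] := Polynomial.isLocalization _ _
  have hM : M ≤ nonZeroDivisors ℤ[X] := by
    rintro _ ⟨z, hz, rfl⟩
    rw [mem_nonZeroDivisors_iff_ne_zero]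
    have : z ≠ 0 := nonZeroDivisors.ne_zero hz
    simpa using this
  refine ⟨IsLocalization.integerNormalization M P, ?_, ?_⟩
  · rwa [Ne, IsLocalization.integerNormalization_eq_zero_iff hM]
  · have h2 := IsLocalization.integerNormalization_eval₂_eq_zero M _ P h
    have e : (Polynomial.coeToPowerSeries.ringHom (R := ℚ)).comp (algebraMap ℤ[X] ℚ[X])
        = (PowerSeries.map (Int.castRingHom ℚ)).comp (Polynomial.coeToPowerSeries.ringHom (R := ℤ)) := by
      refine RingHom.ext fun x => ?_
      simp only [RingHom.comp_apply, Polynomial.coeToPowerSeries.ringHom_apply]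
      exact Polynomial.polynomial_map_coe
    rw [e, ← hom_eval₂] at h2
    exact (map_eq_zero_iff _ (PowerSeries.map_injective _ (RingHom.injective_int _))).1 h2

open Polynomial in
theorem transc_F : ¬ IsAlgebraicPS (PowerSeries.mk fun m => ((bb m : ℕ) : ℚ) ^ 2) := by
  rintro ⟨P, hP, h⟩
  have hm : (PowerSeries.mk fun m => ((bb m : ℕ) : ℚ) ^ 2) =
      PowerSeries.map (Int.castRingHom ℚ) (PowerSeries.mk fun m => ((bb m : ℕ) : ℤ) ^ 2) := by
    ext m; simp
  rw [hm] at h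
  obtain ⟨Q, hQ, hQf⟩ := clear_denominators P hP _ h
  obtain ⟨i, hi⟩ : ∃ i, Q.coeff i ≠ 0 := by
    by_contra hcon; push Not at hcon; exact hQ (Polynomial.ext (by simpa using hcon))
  obtain ⟨j, hj⟩ : ∃ j, (Q.coeff i).coeff j ≠ 0 := by
    by_contra hcon; push Not at hcon; exact hi (Polynomial.ext (by simpa using hcon))
  obtain ⟨p, hpge, hpp⟩ := Nat.exists_infinite_primes
    (((Q.coeff i).coeff j).natAbs + Q.natDegree + 3)
  have : Fact p.Prime := ⟨hpp⟩
  let Q' : (ZMod p)[X][X] := Q.map (mapRingHom (Int.castRingHom (ZMod p)))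
  have hQ' : Q' ≠ 0 := by
    intro h0
    have h1 : ((Q'.coeff i).coeff j) = 0 := by rw [h0]; simp
    simp only [Q', coeff_map, coe_mapRingHom] at h1
    simp only [eq_intCast, ZMod.intCast_zmod_eq_zero_iff_dvd] at h1
    have h2 := Int.natAbs_dvd_natAbs.2 h1
    have h3 := Nat.le_of_dvd (Int.natAbs_pos.2 hj) h2
    simp at h3
    omega
  have hev : Q'.eval₂ (Polynomial.coeToPowerSeries.ringHom)
      (PowerSeries.mk fun m => (bb m : ZMod p) ^ 2) = 0 := by
    have h1 := congrArg (PowerSeries.map (Int.castRingHom (ZMod p))) hQf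
    rw [hom_eval₂, map_zero] at h1
    rw [eval₂_map]
    have e : (Polynomial.coeToPowerSeries.ringHom (R := ZMod p)).comp (mapRingHom (Int.castRingHom (ZMod p)))
        = (PowerSeries.map (Int.castRingHom (ZMod p))).comp (Polynomial.coeToPowerSeries.ringHom (R := ℤ)) := by
      refine RingHom.ext fun x => ?_
      simp only [RingHom.comp_apply, Polynomial.coeToPowerSeries.ringHom_apply]
      exact Polynomial.polynomial_map_coe
    rw [e]
    convert h1 using 2
    ext m; simp
  have h1 := degree_bound (p := p) (by omega) Q' hQ' hev
  have h2 : Q'.natDegree ≤ Q.natDegree := natDegree_map_le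
  omega

open Polynomial in
theorem isAlgebraicPS_iff (f : PowerSeries ℚ) : IsAlgebraicPS f ↔ IsAlgebraic ℚ[X] f := by
  have halg : (algebraMap ℚ[X] (PowerSeries ℚ)) = Polynomial.coeToPowerSeries.ringHom := by
    ext x <;> simp [PowerSeries.algebraMap_apply']
  unfold IsAlgebraicPS IsAlgebraic
  simp only [aeval_def, halg]

open Polynomial in
theorem isAlgebraic_derivative (f : PowerSeries ℚ) (hf : IsAlgebraic ℚ[X] f) :
    IsAlgebraic ℚ[X] (PowerSeries.derivative ℚ f) := by
  have halg : (algebraMap ℚ[X] (PowerSeries ℚ)) = Polynomial.coeToPowerSeries.ringHom := by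
    ext x <;> simp [PowerSeries.algebraMap_apply']
  have hinj : Function.Injective (algebraMap ℚ[X] (PowerSeries ℚ)) := by
    rw [halg]; exact Polynomial.coe_injective _
  have step : ∀ n : ℕ, ∀ P : ℚ[X][X], P.natDegree = n → P ≠ 0 → aeval f P = 0 →
      ∃ P : ℚ[X][X], aeval f P = 0 ∧ aeval f (derivative P) ≠ 0 := by
    intro n
    induction n using Nat.strong_induction_on with
    | _ n ih =>
      intro P hn hP h0
      by_cases hd : aeval f (derivative P) = 0
      · have hpos : P.natDegree ≠ 0 := by
          intro hz
          rw [eq_C_of_natDegree_eq_zero hz, aeval_C] at h0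
          have h1 := (map_eq_zero_iff _ hinj).1 h0
          apply hP
          rw [eq_C_of_natDegree_eq_zero hz, h1, C_0]
        refine ih _ ?_ (derivative P) rfl ?_ hd
        · rw [← hn]; exact natDegree_derivative_lt hpos
        · intro hz
          exact hpos (derivative_eq_zero.1 hz)
      · exact ⟨P, h0, hd⟩
  have chain : ∀ P : ℚ[X][X], ∃ Q : ℚ[X][X], PowerSeries.derivative ℚ (aeval f P) =
      aeval f Q + aeval f (derivative P) * PowerSeries.derivative ℚ f := by
    intro P
    induction P using Polynomial.induction_on' with
    | add p q hp hq =>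
      obtain ⟨Q1, h1⟩ := hp
      obtain ⟨Q2, h2⟩ := hq
      refine ⟨Q1 + Q2, ?_⟩
      simp only [map_add, h1, h2]
      ring
    | monomial n a =>
      refine ⟨monomial n (derivative a), ?_⟩
      simp only [aeval_monomial, derivative_monomial, Derivation.leibniz, smul_eq_mul, halg,
        PowerSeries.derivative_pow, Polynomial.coeToPowerSeries.ringHom_apply,
        PowerSeries.derivative_coe, map_mul]
      have hn : (((n : ℚ[X]) : PowerSeries ℚ)) = (n : PowerSeries ℚ) :=
        map_natCast (Polynomial.coeToPowerSeries.ringHom (R := ℚ)) n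
      rw [hn]
      ring
  have hf' := hf
  obtain ⟨P, hP, h0⟩ := hf
  obtain ⟨P, h0, hd⟩ := step _ P rfl hP h0
  obtain ⟨Q, hQ⟩ := chain P
  have hall : ∀ R : ℚ[X][X], IsAlgebraic ℚ[X] (aeval f R) := by
    intro R
    have hm : f ∈ Subalgebra.algebraicClosure ℚ[X] (PowerSeries ℚ) := by
      rw [Subalgebra.mem_algebraicClosure]; exact hf'
    rw [← Subalgebra.mem_algebraicClosure]
    exact Algebra.adjoin_le (Set.singleton_subset_iff.2 hm) (aeval_mem_adjoin_singleton _ _)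
  refine IsAlgebraic.of_mul (y := aeval f (derivative P)) (mem_nonZeroDivisors_of_ne_zero hd) (hall _) ?_
  have : aeval f (derivative P) * PowerSeries.derivative ℚ f = aeval f (-Q) := by
    rw [h0, map_zero] at hQ
    rw [map_neg]
    linear_combination -hQ
  rw [this]
  exact hall _

theorem transc_H : ¬ IsAlgebraicPS (PowerSeries.mk fun m =>
    ((if m % 2 = 0 then (catalan (m / 2)) ^ 2 else 0 : ℕ) : ℚ)) := by
  intro h
  apply transc_F
  rw [isAlgebraicPS_iff] at h ⊢
  set H : PowerSeries ℚ := PowerSeries.mk fun m =>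
    ((if m % 2 = 0 then (catalan (m / 2)) ^ 2 else 0 : ℕ) : ℚ) with hH
  have hX : ∀ q : Polynomial ℚ, IsAlgebraic (Polynomial ℚ) (q : PowerSeries ℚ) := by
    intro q
    have := isAlgebraic_algebraMap (R := Polynomial ℚ) (A := PowerSeries ℚ) q
    simpa [PowerSeries.algebraMap_apply'] using this
  have hth : ∀ g : PowerSeries ℚ, IsAlgebraic (Polynomial ℚ) g →
      IsAlgebraic (Polynomial ℚ) (PowerSeries.X * PowerSeries.derivative ℚ g + 2 * g) := by
    intro g hg
    refine IsAlgebraic.add (IsAlgebraic.mul ?_ (isAlgebraic_derivative g hg)) (IsAlgebraic.mul ?_ hg)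
    · simpa using hX Polynomial.X
    · have := hX (Polynomial.C 2)
      have e : PowerSeries.C (2:ℚ) = 2 := map_ofNat _ 2
      rw [Polynomial.coe_C, e] at this
      exact this
  have hc : ∀ g : PowerSeries ℚ, ∀ m, PowerSeries.coeff m (PowerSeries.X * PowerSeries.derivative ℚ g + 2 * g)
      = (m + 2) * PowerSeries.coeff m g := by
    intro g m
    have e : PowerSeries.C (2:ℚ) = 2 := map_ofNat _ 2
    rw [← e, map_add, PowerSeries.coeff_C_mul]
    rcases m with _ | m
    · simp
    · rw [PowerSeries.coeff_succ_X_mul, PowerSeries.coeff_derivative]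
      push_cast; ring
  have h4 := IsAlgebraic.mul (hX (Polynomial.C (1/4))) (hth _ (hth _ h))
  refine Eq.subst (motive := fun z => IsAlgebraic (Polynomial ℚ) z) ?_ h4
  symm
  refine PowerSeries.ext fun m => ?_
  rw [Polynomial.coe_C, PowerSeries.coeff_C_mul, hc, hc, hH, PowerSeries.coeff_mk, PowerSeries.coeff_mk]
  unfold bb
  split_ifs with hm
  · obtain ⟨k, rfl⟩ : ∃ k, m = 2 * k := ⟨m / 2, by omega⟩
    rw [show 2 * k / 2 = k by omega, ← succ_mul_catalan_eq_centralBinom]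
    push_cast
    ring
  · simp

section SL2part
open Matrix Finset

abbrev Idx (n : ℕ) := Fin n → Fin 2
abbrev M2 := Matrix (Fin 2) (Fin 2) ℂ

noncomputable def RR {n : ℕ} (g : Fin n → M2) : Matrix (Idx n) (Idx n) ℂ :=
  Matrix.of fun I J => ∏ i, g i (I i) (J i)

theorem RR_apply {n : ℕ} (g : Fin n → M2) (I J : Idx n) : RR g I J = ∏ i, g i (I i) (J i) := rfl

theorem RR_mul {n : ℕ} (g h : Fin n → M2) : RR g * RR h = RR (g * h) := by
  ext I J
  simp only [Matrix.mul_apply, RR_apply, Pi.mul_apply, ← Finset.prod_mul_distrib]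
  rw [Finset.prod_univ_sum, Fintype.piFinset_univ]

theorem RR_one {n : ℕ} : RR (1 : Fin n → M2) = 1 := by
  ext I J
  simp only [RR_apply, Pi.one_apply, Matrix.one_apply, Fintype.prod_ite_zero, ← funext_iff]
  simp

theorem RR_single {n : ℕ} (i : Fin n) (N : M2) (I J : Idx n) :
    RR (Pi.mulSingle i N) I J = N (I i) (J i) * ∏ j ∈ univ.erase i, (1 : M2) (I j) (J j) := by
  rw [RR_apply, ← Finset.mul_prod_erase _ _ (Finset.mem_univ i), Pi.mulSingle_eq_same]
  congr 1
  refine Finset.prod_congr rfl fun j hj => ?_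
  rw [Pi.mulSingle_eq_of_ne (Finset.ne_of_mem_erase hj)]

theorem RR_single_sub {n : ℕ} (i : Fin n) (N M : M2) :
    RR (Pi.mulSingle i (N - M)) = RR (Pi.mulSingle i N) - RR (Pi.mulSingle i M) := by
  ext I J
  simp only [RR_single, Matrix.sub_apply, sub_mul]

noncomputable def DD (n : ℕ) (N : M2) : Matrix (Idx n) (Idx n) ℂ := ∑ i, RR (Pi.mulSingle i N)

theorem DD_comm (n : ℕ) (N M : M2) : DD n N * DD n M - DD n M * DD n N = DD n (N * M - M * N) := by
  have h1 : DD n N * DD n M = ∑ i, ∑ j, RR (Pi.mulSingle i N * Pi.mulSingle j M) := by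
    simp only [DD, Finset.sum_mul_sum, RR_mul]
  have h2 : DD n M * DD n N = ∑ i, ∑ j, RR (Pi.mulSingle j M * Pi.mulSingle i N) := by
    simp only [DD, Finset.sum_mul_sum, RR_mul]
    exact Finset.sum_comm
  rw [h1, h2, ← Finset.sum_sub_distrib]
  simp only [DD]
  refine Finset.sum_congr rfl fun i _ => ?_
  rw [← Finset.sum_sub_distrib, Finset.sum_eq_single i]
  · rw [RR_single_sub, Pi.mulSingle_mul, Pi.mulSingle_mul]
  · intro j _ hj
    rw [(Pi.mulSingle_commute (f := fun _ : Fin n => M2) (Ne.symm hj) N M).eq, sub_self]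
  · simp

theorem DD_transpose (n : ℕ) (N : M2) : (DD n N)ᵀ = DD n Nᵀ := by
  ext I J
  simp only [DD, Matrix.transpose_apply, Matrix.sum_apply, RR_single]
  refine Finset.sum_congr rfl fun i _ => ?_
  simp only [Matrix.one_apply, eq_comm]

theorem RR_hasDerivAt {n : ℕ} (N : M2) (hN : N * N = 0) (I J : Idx n) (s : ℂ) :
    HasDerivAt (fun s : ℂ => RR (fun _ : Fin n => 1 + s • N) I J)
      ((RR (fun _ : Fin n => 1 + s • N) * DD n N) I J) s := by
  have h : ∀ i ∈ (Finset.univ : Finset (Fin n)),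
      HasDerivAt (fun s : ℂ => (1 + s • N) (I i) (J i)) (N (I i) (J i)) s := by
    intro i _
    simp only [Matrix.add_apply, Matrix.smul_apply, smul_eq_mul]
    simpa using ((hasDerivAt_id s).mul_const (N (I i) (J i))).const_add ((1 : M2) (I i) (J i))
  have h2 := HasDerivAt.fun_finsetProd h
  simp only [RR_apply]
  refine h2.congr_deriv (Eq.symm ?_)
  have hD : DD n N = ∑ i, RR (Pi.mulSingle i N) := rfl
  rw [hD, Finset.mul_sum, Matrix.sum_apply]
  refine Finset.sum_congr rfl fun i _ => ?_
  rw [RR_mul, RR_apply, ← Finset.mul_prod_erase _ _ (Finset.mem_univ i), smul_eq_mul, mul_comm]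
  congr 1
  · refine Finset.prod_congr rfl fun j hj => ?_
    rw [Pi.mul_apply, Pi.mulSingle_eq_of_ne (Finset.ne_of_mem_erase hj), mul_one]
  · rw [Pi.mul_apply, Pi.mulSingle_eq_same, add_mul, one_mul, smul_mul_assoc, hN, smul_zero, add_zero]

theorem inv_iff_DD {n : ℕ} (N : M2) (hN : N * N = 0) (x : Idx n → ℂ) :
    (∀ s : ℂ, RR (fun _ : Fin n => 1 + s • N) *ᵥ x = x) ↔ DD n N *ᵥ x = 0 := by
  have hd : ∀ (I : Idx n) (s : ℂ), HasDerivAt (fun s : ℂ => (RR (fun _ : Fin n => 1 + s • N) *ᵥ x) I)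
      ((RR (fun _ : Fin n => 1 + s • N) *ᵥ (DD n N *ᵥ x)) I) s := by
    intro I s
    rw [Matrix.mulVec_mulVec]
    simp only [Matrix.mulVec, dotProduct]
    exact HasDerivAt.fun_sum fun J _ => (RR_hasDerivAt N hN I J s).mul_const (x J)
  have h0 : RR (fun _ : Fin n => 1 + (0:ℂ) • N) = 1 := by
    rw [← RR_one]; congr 1; ext; simp
  constructor
  · intro h
    ext I
    have h1 := hd I 0
    simp only [h] at h1
    rw [h0, Matrix.one_mulVec] at h1
    exact h1.unique (hasDerivAt_const _ _)
  · intro h s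
    ext I
    have hdiff : Differentiable ℂ (fun s : ℂ => (RR (fun _ : Fin n => 1 + s • N) *ᵥ x) I) :=
      fun s => (hd I s).differentiableAt
    have hz : ∀ s, deriv (fun s : ℂ => (RR (fun _ : Fin n => 1 + s • N) *ᵥ x) I) s = 0 := by
      intro s
      rw [(hd I s).deriv, h, Matrix.mulVec_zero]; rfl
    have := is_const_of_deriv_eq_zero hdiff hz s 0
    rw [this, h0, Matrix.one_mulVec]

def Em : M2 := !![0, 1; 0, 0]
def Fm : M2 := !![0, 0; 1, 0]

noncomputable def slInv (n : ℕ) : Submodule ℂ (Idx n → ℂ) where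
  carrier := {x | ∀ g : Matrix.SpecialLinearGroup (Fin 2) ℂ, RR (fun _ : Fin n => (g : M2)) *ᵥ x = x}
  add_mem' := by
    intro a b ha hb g
    rw [Matrix.mulVec_add, ha g, hb g]
  zero_mem' := by intro g; simp
  smul_mem' := by
    intro c x hx g
    rw [Matrix.mulVec_smul, hx g]

def zc {n : ℕ} (I : Idx n) : ℕ := (univ.filter fun i => I i = 0).card

theorem HH_eq (n : ℕ) : DD n (Em * Fm - Fm * Em) = Matrix.diagonal fun I => (2 * zc I - n : ℂ) := by
  have hm : Em * Fm - Fm * Em = !![1, 0; 0, -1] := by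
    simp [Em, Fm]
  rw [hm]
  ext I J
  simp only [DD, Matrix.sum_apply, RR_single]
  by_cases hIJ : I = J
  · subst hIJ
    simp only [Matrix.diagonal_apply_eq, Matrix.one_apply_eq, Finset.prod_const_one, mul_one]
    have : ∀ i, (!![1, 0; 0, -1] : M2) (I i) (I i) = 2 * (if I i = 0 then 1 else 0) - 1 := by
      intro i
      rcases Fin.exists_fin_two.1 ⟨I i, rfl⟩ with h | h <;> rw [h] <;> norm_num
    simp only [this, Finset.sum_sub_distrib, ← Finset.mul_sum, zc]
    simp
  · rw [Matrix.diagonal_apply_ne _ hIJ]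
    obtain ⟨j, hj⟩ := Function.ne_iff.1 hIJ
    refine Finset.sum_eq_zero fun i _ => ?_
    by_cases hij : i = j
    · subst hij
      have : (!![1, 0; 0, -1] : M2) (I i) (J i) = 0 := by
        revert hj
        generalize I i = a
        generalize J i = b
        fin_cases a <;> fin_cases b <;> simp
      rw [this, zero_mul]
    · have hz : ∏ j ∈ univ.erase i, (1 : M2) (I j) (J j) = 0 :=
        Finset.prod_eq_zero (i := j) (Finset.mem_erase.2 ⟨Ne.symm hij, mem_univ _⟩) (Matrix.one_apply_ne hj)
      rw [hz, mul_zero]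

theorem E_entry (n : ℕ) (I J : Idx n) (h : zc I ≠ zc J + 1) : DD n Em I J = 0 := by
  have h1 := DD_comm n (Em * Fm - Fm * Em) Em
  have h2 : (Em * Fm - Fm * Em) * Em - Em * (Em * Fm - Fm * Em) = Em - (0 - Em) := by
    simp [Em, Fm]
  have h3 : DD n (Em - (0 - Em)) = DD n Em + DD n Em := by
    ext I J
    simp only [DD, Matrix.sum_apply, RR_single, Matrix.sub_apply, Matrix.add_apply, Matrix.zero_apply, ← Finset.sum_add_distrib]
    refine Finset.sum_congr rfl fun i _ => by ring
  rw [h2, HH_eq, h3] at h1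
  have h4 := congrFun (congrFun h1 I) J
  simp only [Matrix.sub_apply, Matrix.diagonal_mul, Matrix.mul_diagonal, Matrix.add_apply] at h4
  have h5 : ((zc I : ℂ) - (zc J + 1)) * DD n Em I J = 0 := by linear_combination h4 / 2
  rcases mul_eq_zero.1 h5 with h6 | h6
  · exfalso
    apply h
    have := sub_eq_zero.1 h6
    exact_mod_cast this
  · exact h6

theorem Em_T : Emᵀ = Fm := by ext i j; fin_cases i <;> fin_cases j <;> simp [Em, Fm]
theorem Fm_T : Fmᵀ = Em := by ext i j; fin_cases i <;> fin_cases j <;> simp [Em, Fm]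

theorem DD_real (n : ℕ) (N : M2) (hN : N.map star = N) : (DD n N)ᴴ = DD n Nᵀ := by
  rw [← DD_transpose]
  ext I J
  simp only [DD, Matrix.conjTranspose_apply, Matrix.transpose_apply, Matrix.sum_apply, RR_single, star_sum, star_mul', star_prod]
  refine Finset.sum_congr rfl fun i _ => ?_
  have h1 : ∀ a b, star (N a b) = N a b := fun a b => congrFun (congrFun hN a) b
  have h2 : ∀ a b, star ((1 : M2) a b) = (1 : M2) a b := by
    intro a b; by_cases h : a = b
    · subst h; simp
    · simp [Matrix.one_apply_ne h]
  simp only [h1, h2]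

theorem norm_identity (n : ℕ) (x : Idx n → ℂ) :
    star x ⬝ᵥ ((Matrix.diagonal fun I => (2 * zc I - n : ℂ)) *ᵥ x) =
      star (DD n Fm *ᵥ x) ⬝ᵥ (DD n Fm *ᵥ x) - star (DD n Em *ᵥ x) ⬝ᵥ (DD n Em *ᵥ x) := by
  have hE : (DD n Em)ᴴ = DD n Fm := by
    rw [DD_real, Em_T]
    ext i j; fin_cases i <;> fin_cases j <;> simp [Em]
  have hF : (DD n Fm)ᴴ = DD n Em := by
    rw [DD_real, Fm_T]
    ext i j; fin_cases i <;> fin_cases j <;> simp [Fm]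
  rw [Matrix.star_mulVec, Matrix.star_mulVec, hE, hF, ← HH_eq, ← DD_comm, Matrix.sub_mulVec,
    dotProduct_sub, ← Matrix.dotProduct_mulVec, ← Matrix.dotProduct_mulVec, Matrix.mulVec_mulVec,
    Matrix.mulVec_mulVec]

theorem mem_slInv {n : ℕ} (x : Idx n → ℂ) : x ∈ slInv n ↔
    DD n Em *ᵥ x = 0 ∧ (Matrix.diagonal fun I => (2 * zc I - n : ℂ)) *ᵥ x = 0 := by
  have hEE : Em * Em = 0 := by
    ext i j; fin_cases i <;> fin_cases j <;> simp [Em, Matrix.mul_apply, Fin.sum_univ_two]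
  have hFF : Fm * Fm = 0 := by
    ext i j; fin_cases i <;> fin_cases j <;> simp [Fm, Matrix.mul_apply, Fin.sum_univ_two]
  constructor
  · intro hx
    have hE : DD n Em *ᵥ x = 0 := by
      rw [← inv_iff_DD Em hEE]
      intro s
      exact hx ⟨1 + s • Em, by simp [Em, Matrix.det_fin_two]⟩
    have hF : DD n Fm *ᵥ x = 0 := by
      rw [← inv_iff_DD Fm hFF]
      intro s
      exact hx ⟨1 + s • Fm, by simp [Fm, Matrix.det_fin_two]⟩
    refine ⟨hE, ?_⟩
    rw [← HH_eq, ← DD_comm, Matrix.sub_mulVec, ← Matrix.mulVec_mulVec, ← Matrix.mulVec_mulVec, hE, hF]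
    simp
  · rintro ⟨hE, hH⟩
    have hF : DD n Fm *ᵥ x = 0 := by
      have := norm_identity n x
      rw [hE, hH] at this
      simp only [dotProduct_zero, sub_zero] at this
      open ComplexOrder in
      exact dotProduct_star_self_eq_zero.1 this.symm
    rw [← inv_iff_DD Em hEE] at hE
    rw [← inv_iff_DD Fm hFF] at hF
    have hmul : ∀ a b : M2, RR (fun _ : Fin n => a) *ᵥ x = x → RR (fun _ : Fin n => b) *ᵥ x = x →
        RR (fun _ : Fin n => a * b) *ᵥ x = x := by
      intro a b ha hb
      have : (fun _ : Fin n => a * b) = (fun _ => a) * (fun _ => b) := rfl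
      rw [this, ← RR_mul, ← Matrix.mulVec_mulVec, hb, ha]
    have hc : ∀ a b c d : ℂ, a * d - b * c = 1 → c ≠ 0 →
        RR (fun _ : Fin n => (!![a, b; c, d] : M2)) *ᵥ x = x := by
      intro a b c d hdet hc
      have : (!![a, b; c, d] : M2) = (1 + ((a - 1) / c) • Em) * ((1 + c • Fm) * (1 + ((d - 1) / c) • Em)) := by
        ext i j
        fin_cases i <;> fin_cases j <;> simp [Em, Fm, Matrix.mul_apply, Fin.sum_univ_two, Matrix.one_apply] <;> field_simp <;> first | ring1 | linear_combination -hdet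
      rw [this]
      exact hmul _ _ (hE _) (hmul _ _ (hF _) (hE _))
    intro g
    obtain ⟨g, hg⟩ := g
    simp only
    rw [Matrix.eta_fin_two g] at hg ⊢
    rw [Matrix.det_fin_two_of] at hg
    by_cases h10 : g 1 0 = 0
    · have h11 : g 1 1 ≠ 0 := by
        intro h; rw [h, h10] at hg; simp at hg
      have : (!![g 0 0, g 0 1; g 1 0, g 1 1] : M2) =
          !![g 0 0 + g 0 1, g 0 1; g 1 0 + g 1 1, g 1 1] * (1 + (-1 : ℂ) • Fm) := by
        ext i j
        fin_cases i <;> fin_cases j <;> simp [Fm, Matrix.mul_apply, Fin.sum_univ_two, Matrix.one_apply]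
      rw [this]
      refine hmul _ _ (hc _ _ _ _ ?_ ?_) (hF _)
      · linear_combination hg
      · rw [h10, zero_add]; exact h11
    · exact hc _ _ _ _ hg h10

end SL2part

section Dim
open Matrix Finset

theorem card_level (n a : ℕ) : Fintype.card {I : Idx n // zc I = a} = n.choose a := by
  have e : {I : Idx n // zc I = a} ≃ {s : Finset (Fin n) // s.card = a} :=
    { toFun := fun I => ⟨univ.filter fun i => I.1 i = 0, I.2⟩
      invFun := fun s => ⟨fun i => if i ∈ s.1 then 0 else 1, by
        have h := s.2
        simp only [zc]
        convert h using 2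
        ext i
        by_cases hi : i ∈ s.1 <;> simp [hi]⟩
      left_inv := by
        rintro ⟨I, hI⟩
        ext i : 2
        simp only [Finset.mem_filter, Finset.mem_univ, true_and]
        rcases Fin.exists_fin_two.1 ⟨I i, rfl⟩ with h | h <;> simp [h]
      right_inv := by
        rintro ⟨s, hs⟩
        ext i
        by_cases hi : i ∈ s <;> simp [hi] }
  rw [Fintype.card_congr e, Fintype.card_finset_len, Fintype.card_fin]

theorem finrank_slInv_odd (n : ℕ) (hn : n % 2 = 1) : Module.finrank ℂ (slInv n) = 0 := by
  have : slInv n = ⊥ := by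
    rw [eq_bot_iff]
    intro x hx
    rw [mem_slInv] at hx
    rw [Submodule.mem_bot]
    ext I
    have h := congrFun hx.2 I
    rw [Matrix.mulVec_diagonal] at h
    rcases mul_eq_zero.1 h with h | h
    · exfalso
      have h2 : (2 * zc I : ℂ) = n := sub_eq_zero.1 h
      have h3 : 2 * zc I = n := by exact_mod_cast h2
      omega
    · exact h
  rw [this]; exact finrank_bot ℂ _

noncomputable def extZ (n a : ℕ) : ({I : Idx n // zc I = a} → ℂ) →ₗ[ℂ] (Idx n → ℂ) where
  toFun y := fun I => if h : zc I = a then y ⟨I, h⟩ else 0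
  map_add' := by
    intro x y; ext I; by_cases h : zc I = a <;> simp [h]
  map_smul' := by
    intro c y; ext I; by_cases h : zc I = a <;> simp [h]

theorem extZ_val {n a : ℕ} (y : {I : Idx n // zc I = a} → ℂ) (I : {I : Idx n // zc I = a}) :
    extZ n a y I.1 = y I := by
  simp [extZ, I.2]

theorem extZ_ne {n a : ℕ} (y : {I : Idx n // zc I = a} → ℂ) (I : Idx n) (h : zc I ≠ a) :
    extZ n a y I = 0 := by
  simp [extZ, h]

theorem extZ_inj (n a : ℕ) : Function.Injective (extZ n a) := by
  intro x y h
  ext I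
  rw [← extZ_val x, ← extZ_val y, h]

theorem mulVec_extZ {n a b : ℕ} (A : Matrix (Idx n) (Idx n) ℂ) (y : {I : Idx n // zc I = a} → ℂ)
    (hA : ∀ I J, zc J = a → zc I ≠ b → A I J = 0) :
    A *ᵥ (extZ n a y) = extZ n b
      ((A.submatrix (Subtype.val : {I : Idx n // zc I = b} → Idx n)
        (Subtype.val : {I : Idx n // zc I = a} → Idx n)) *ᵥ y) := by
  ext I
  by_cases h : zc I = b
  · have := extZ_val ((A.submatrix (Subtype.val : {I : Idx n // zc I = b} → Idx n)
        (Subtype.val : {I : Idx n // zc I = a} → Idx n)) *ᵥ y) ⟨I, h⟩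
    rw [this]
    simp only [Matrix.mulVec, dotProduct, Matrix.submatrix_apply]
    have h2 := Finset.sum_subtype (F := inferInstance) (p := fun J => zc J = a) (univ.filter fun J => zc J = a) (by simp)
      (fun J => A I J * extZ n a y J)
    simp only [extZ_val] at h2
    rw [← h2]
    symm
    refine Finset.sum_filter_of_ne fun J _ hne => ?_
    by_contra hJ
    apply hne
    rw [extZ_ne _ _ hJ, mul_zero]
  · rw [extZ_ne _ _ h]
    simp only [Matrix.mulVec, dotProduct]
    refine Finset.sum_eq_zero fun J _ => ?_
    by_cases hJ : zc J = a
    · rw [hA I J hJ h, zero_mul]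
    · rw [extZ_ne _ _ hJ, mul_zero]

theorem finrank_slInv_even (k : ℕ) : Module.finrank ℂ (slInv (2 * k)) = catalan k := by
  set n := 2 * k with hn
  have hnC : (n : ℂ) = 2 * k := by rw [hn]; push_cast; rfl
  set B : Matrix {I : Idx n // zc I = k + 1} {I : Idx n // zc I = k} ℂ :=
    (DD n Em).submatrix Subtype.val Subtype.val with hB
  have hE : ∀ y, DD n Em *ᵥ (extZ n k y) = extZ n (k + 1) (B *ᵥ y) := by
    intro y
    exact mulVec_extZ _ _ fun I J hJ hI => E_entry n I J (by rw [hJ]; exact hI)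
  have hF : ∀ y, DD n Fm *ᵥ (extZ n (k + 1) y) = extZ n k (Bᵀ *ᵥ y) := by
    intro y
    rw [← Em_T, ← DD_transpose]
    exact mulVec_extZ _ _ fun I J hJ hI => E_entry n J I (by omega)
  have hmap : slInv n = (LinearMap.ker B.mulVecLin).map (extZ n k) := by
    ext x
    rw [mem_slInv, Submodule.mem_map]
    constructor
    · rintro ⟨h1, h2⟩
      have hx : extZ n k (fun I => x I.1) = x := by
        ext I
        by_cases h : zc I = k
        · exact extZ_val _ ⟨I, h⟩
        · rw [extZ_ne _ _ h]
          have h3 := congrFun h2 I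
          rw [Matrix.mulVec_diagonal] at h3
          rcases mul_eq_zero.1 h3 with h4 | h4
          · exfalso
            have h5 : (2 * zc I : ℂ) = n := sub_eq_zero.1 h4
            have h6 : 2 * zc I = n := by exact_mod_cast h5
            omega
          · exact h4.symm
      refine ⟨_, ?_, hx⟩
      rw [LinearMap.mem_ker, Matrix.mulVecLin_apply]
      apply extZ_inj
      rw [← hE, hx, h1, map_zero]
    · rintro ⟨y, hy, rfl⟩
      rw [LinearMap.mem_ker, Matrix.mulVecLin_apply] at hy
      refine ⟨by rw [hE, hy, map_zero], ?_⟩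
      ext I
      rw [Matrix.mulVec_diagonal]
      by_cases h : zc I = k
      · rw [h, hnC]; simp
      · rw [extZ_ne _ _ h]; simp
  have hinj : Function.Injective Bᵀ.mulVecLin := by
    rw [← LinearMap.ker_eq_bot, LinearMap.ker_eq_bot']
    intro y hy
    rw [Matrix.mulVecLin_apply] at hy
    have h1 := norm_identity n (extZ n (k + 1) y)
    have h2 : (Matrix.diagonal fun I => (2 * zc I - n : ℂ)) *ᵥ (extZ n (k + 1) y) =
        (2 : ℂ) • extZ n (k + 1) y := by
      ext I
      rw [Matrix.mulVec_diagonal, Pi.smul_apply, smul_eq_mul]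
      by_cases h : zc I = k + 1
      · rw [h, hnC]; push_cast; ring
      · rw [extZ_ne _ _ h]; simp
    rw [hF, hy, map_zero, h2, dotProduct_smul, dotProduct_zero, zero_sub] at h1
    have h3 : extZ n (k + 1) y = 0 := by
      open ComplexOrder in
      have p1 : 0 ≤ star (extZ n (k + 1) y) ⬝ᵥ extZ n (k + 1) y := dotProduct_star_self_nonneg _
      open ComplexOrder in
      have p2 : 0 ≤ star (DD n Em *ᵥ extZ n (k + 1) y) ⬝ᵥ (DD n Em *ᵥ extZ n (k + 1) y) :=
        dotProduct_star_self_nonneg _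
      open ComplexOrder in
      apply dotProduct_star_self_eq_zero.1
      rw [Complex.le_def] at p1 p2
      have q := congrArg Complex.re h1
      rw [smul_eq_mul, Complex.mul_re] at q
      simp only [Complex.re_ofNat, Complex.im_ofNat, zero_mul, sub_zero, Complex.neg_re] at q
      have a1 := p1.1
      have a2 := p2.1
      simp only [Complex.zero_re] at a1 a2
      apply Complex.ext
      · rw [Complex.zero_re]; linarith
      · exact p1.2.symm
    apply extZ_inj n (k + 1)
    rw [h3, map_zero]
  have hrank : B.rank = n.choose (k + 1) := by
    rw [← Matrix.rank_transpose, Matrix.rank, LinearMap.finrank_range_of_inj hinj,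
      Module.finrank_fintype_fun_eq_card, card_level]
  have hrn := LinearMap.finrank_range_add_finrank_ker B.mulVecLin
  rw [Module.finrank_fintype_fun_eq_card, card_level] at hrn
  have hr2 : Module.finrank ℂ (LinearMap.range B.mulVecLin) = n.choose (k + 1) := hrank
  have hfin : Module.finrank ℂ (slInv n) = Module.finrank ℂ (LinearMap.ker B.mulVecLin) := by
    rw [hmap]
    exact (LinearEquiv.finrank_eq (Submodule.equivMapOfInjective _ (extZ_inj n k) _)).symm
  rw [hfin]
  rw [hr2] at hrn
  have c1 := succ_mul_catalan_eq_centralBinom k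
  rw [Nat.centralBinom_eq_two_mul_choose, ← hn] at c1
  have c2 := Nat.choose_succ_right_eq n k
  rw [show n - k = k by omega] at c2
  set d := Module.finrank ℂ (LinearMap.ker B.mulVecLin)
  have : (k + 1) * d = (k + 1) * catalan k := by
    rw [c1]
    nlinarith
  exact Nat.eq_of_mul_eq_mul_left (Nat.succ_pos k) this

end Dim

section Tens
open Matrix Finset

noncomputable def bVW : Module.Basis (Fin 2 × Fin 2) ℂ ((Fin 2 → ℂ) ⊗[ℂ] (Fin 2 → ℂ)) :=
  (Pi.basisFun ℂ (Fin 2)).tensorProduct (Pi.basisFun ℂ (Fin 2))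

noncomputable def bAmb (n : ℕ) : Module.Basis (Fin n → Fin 2 × Fin 2) ℂ (SL2SL2Amb n) :=
  Basis.piTensorProduct fun _ => bVW

noncomputable def theta (n : ℕ) : SL2SL2Amb n ≃ₗ[ℂ] Matrix (Idx n) (Idx n) ℂ :=
  (bAmb n).equivFun ≪≫ₗ
    (LinearEquiv.funCongrLeft ℂ ℂ (Equiv.arrowProdEquivProdArrow (Fin n) (fun _ => Fin 2) (fun _ => Fin 2)).symm) ≪≫ₗ
    (LinearEquiv.curry ℂ ℂ (Idx n) (Idx n)) ≪≫ₗ (Matrix.ofLinearEquiv ℂ)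

theorem theta_apply {n : ℕ} (x : SL2SL2Amb n) (I J : Idx n) :
    theta n x I J = (bAmb n).repr x (fun i => (I i, J i)) := rfl

theorem bVW_repr (g h : M2) (K L : Fin 2 × Fin 2) :
    bVW.repr (TensorProduct.map (Matrix.toLin' g) (Matrix.toLin' h) (bVW L)) K =
      g K.1 L.1 * h K.2 L.2 := by
  obtain ⟨K1, K2⟩ := K
  simp [bVW, Module.Basis.tensorProduct_apply', Module.Basis.tensorProduct_repr_tmul_apply, mul_comm]

theorem theta_map {n : ℕ} (g h : M2) (x : SL2SL2Amb n) :
    theta n (PiTensorProduct.map (fun _ : Fin n =>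
        TensorProduct.map (Matrix.toLin' g) (Matrix.toLin' h)) x) =
      RR (fun _ => g) * theta n x * (RR (fun _ => h))ᵀ := by
  let A : SL2SL2Amb n →ₗ[ℂ] Matrix (Idx n) (Idx n) ℂ :=
    (theta n).toLinearMap ∘ₗ (PiTensorProduct.map (fun _ : Fin n =>
        TensorProduct.map (Matrix.toLin' g) (Matrix.toLin' h)))
  let C : SL2SL2Amb n →ₗ[ℂ] Matrix (Idx n) (Idx n) ℂ :=
    (LinearMap.mulRight ℂ (RR (fun _ : Fin n => h))ᵀ) ∘ₗ (LinearMap.mulLeft ℂ (RR (fun _ : Fin n => g))) ∘ₗ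
      (theta n).toLinearMap
  suffices hAC : A = C from LinearMap.congr_fun hAC x
  refine (bAmb n).ext fun L => ?_
  have hC : C (bAmb n L) = RR (fun _ => g) * theta n (bAmb n L) * (RR (fun _ => h))ᵀ := rfl
  have hA : A (bAmb n L) = theta n (PiTensorProduct.map (fun _ : Fin n =>
        TensorProduct.map (Matrix.toLin' g) (Matrix.toLin' h)) (bAmb n L)) := rfl
  have hth : theta n (bAmb n L) = Matrix.single (fun i => (L i).1) (fun i => (L i).2) 1 := by
    ext I J
    rw [theta_apply, Module.Basis.repr_self, Finsupp.single_apply, Matrix.single_apply]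
    congr 1
    simp only [funext_iff, Prod.ext_iff, forall_and]
  rw [hA, hC, hth]
  ext I J
  rw [theta_apply]
  have h1 : bAmb n L = PiTensorProduct.tprod ℂ fun i => bVW (L i) := by
    simp [bAmb]
  rw [h1, PiTensorProduct.map_tprod, bAmb, Basis.piTensorProduct_repr_tprod_apply]
  simp only [bVW_repr, Finset.prod_mul_distrib]
  rw [Matrix.mul_apply, Finset.sum_eq_single (fun i => (L i).2)]
  · rw [Matrix.mul_single_apply_same, mul_one]; rfl
  · intro K _ hK
    rw [Matrix.mul_single_apply_of_ne _ _ _ _ _ hK, zero_mul]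
  · simp

theorem mem_sl2Inv {n : ℕ} (x : SL2SL2Amb n) : x ∈ sl2sl2Invariants n ↔
    (∀ g : Matrix.SpecialLinearGroup (Fin 2) ℂ, RR (fun _ : Fin n => (g : M2)) * theta n x = theta n x) ∧
    (∀ h : Matrix.SpecialLinearGroup (Fin 2) ℂ, theta n x * (RR (fun _ : Fin n => (h : M2)))ᵀ = theta n x) := by
  have h0 : x ∈ sl2sl2Invariants n ↔ ∀ g h : Matrix.SpecialLinearGroup (Fin 2) ℂ,
      RR (fun _ : Fin n => (g : M2)) * theta n x * (RR (fun _ : Fin n => (h : M2)))ᵀ = theta n x := by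
    simp only [sl2sl2Invariants, Submodule.mem_iInf, LinearMap.mem_eqLocus, LinearMap.id_apply]
    refine forall_congr' fun g => forall_congr' fun h => ?_
    rw [← theta_map, (theta n).injective.eq_iff]
  rw [h0]
  have h1 : RR (fun _ : Fin n => ((1 : Matrix.SpecialLinearGroup (Fin 2) ℂ) : M2)) = 1 := by
    rw [← RR_one]; rfl
  constructor
  · intro h
    constructor
    · intro g
      have := h g 1
      rwa [h1, Matrix.transpose_one, mul_one] at this
    · intro g
      have := h 1 g
      rwa [h1, one_mul] at this
  · rintro ⟨ha, hb⟩ g h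
    rw [ha, hb]

theorem finrank_inv (n : ℕ) :
    Module.finrank ℂ (sl2sl2Invariants n) = Module.finrank ℂ (slInv n) ^ 2 := by
  set d := Module.finrank ℂ (slInv n) with hd
  let β := Module.finBasis ℂ (slInv n)
  let P : Matrix (Idx n) (Fin d) ℂ := Matrix.of fun I a => (β a : Idx n → ℂ) I
  have hPv : ∀ c : Fin d → ℂ, P *ᵥ c = ((β.equivFun.symm c : slInv n) : Idx n → ℂ) := by
    intro c
    ext I
    rw [Module.Basis.equivFun_symm_apply]
    simp only [Matrix.mulVec, dotProduct, P, Matrix.of_apply, Submodule.coe_sum, Submodule.coe_smul,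
      Finset.sum_apply, Pi.smul_apply, smul_eq_mul]
    exact Finset.sum_congr rfl fun a _ => mul_comm _ _
  have hPinj : LinearMap.ker P.mulVecLin = ⊥ := by
    rw [LinearMap.ker_eq_bot']
    intro c hc
    rw [Matrix.mulVecLin_apply, hPv] at hc
    have h2 : β.equivFun.symm c = 0 := Subtype.ext hc
    exact (LinearEquiv.map_eq_zero_iff β.equivFun.symm).1 h2
  obtain ⟨q, hq⟩ := LinearMap.exists_leftInverse_of_injective _ hPinj
  let Q := LinearMap.toMatrix' q
  have hQP : Q * P = 1 := by
    have : P = LinearMap.toMatrix' P.mulVecLin := by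
      rw [← Matrix.toLin'_apply', LinearMap.toMatrix'_toLin']
    rw [this, ← LinearMap.toMatrix'_comp, hq, LinearMap.toMatrix'_id]
  have hPQ : ∀ T : Matrix (Idx n) (Idx n) ℂ, (∀ J, (fun I => T I J) ∈ slInv n) → P * (Q * T) = T := by
    intro T hT
    have hc : T = P * (Matrix.of fun a J => β.equivFun ⟨_, hT J⟩ a) := by
      ext I J
      have := congrFun (hPv (β.equivFun ⟨_, hT J⟩)) I
      rw [LinearEquiv.symm_apply_apply] at this
      exact this.symm
    rw [hc, ← Matrix.mul_assoc Q, hQP, Matrix.one_mul]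
  have hRP : ∀ g : Matrix.SpecialLinearGroup (Fin 2) ℂ, RR (fun _ : Fin n => (g : M2)) * P = P := by
    intro g
    ext I a
    exact congrFun ((β a).2 g) I
  have hcol : ∀ T : Matrix (Idx n) (Idx n) ℂ,
      (∀ g : Matrix.SpecialLinearGroup (Fin 2) ℂ, RR (fun _ : Fin n => (g : M2)) * T = T) →
      P * (Q * T) = T := by
    intro T hT
    apply hPQ
    intro J g
    ext I
    exact congrFun (congrFun (hT g) I) J
  let Ψ : Matrix (Fin d) (Fin d) ℂ →ₗ[ℂ] SL2SL2Amb n := (theta n).symm.toLinearMap ∘ₗ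
    { toFun := fun C => P * C * Pᵀ
      map_add' := by intro a b; rw [Matrix.mul_add, Matrix.add_mul]
      map_smul' := by intro c a; simp }
  have hΨ : ∀ C, theta n (Ψ C) = P * C * Pᵀ := fun C => (theta n).apply_symm_apply _
  have hPQT : Pᵀ * Qᵀ = 1 := by rw [← Matrix.transpose_mul, hQP, Matrix.transpose_one]
  have hinj : Function.Injective Ψ := by
    have hleft : ∀ C, Q * theta n (Ψ C) * Qᵀ = C := by
      intro C
      rw [hΨ, Matrix.mul_assoc, Matrix.mul_assoc, hPQT, Matrix.mul_one, ← Matrix.mul_assoc, hQP,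
        Matrix.one_mul]
    intro a b h
    rw [← hleft a, ← hleft b, h]
  have hrange : LinearMap.range Ψ = sl2sl2Invariants n := by
    ext x
    rw [mem_sl2Inv, LinearMap.mem_range]
    constructor
    · rintro ⟨C, rfl⟩
      rw [hΨ]
      constructor
      · intro g
        rw [Matrix.mul_assoc P, ← Matrix.mul_assoc, hRP]
      · intro g
        rw [Matrix.mul_assoc, ← Matrix.transpose_mul, hRP]
    · rintro ⟨ha, hb⟩
      refine ⟨Q * theta n x * Qᵀ, ?_⟩
      apply (theta n).injective
      rw [hΨ]
      have h1 := hcol _ ha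
      have h2 := hcol (theta n x)ᵀ (by
        intro g
        rw [← Matrix.transpose_transpose (RR _), ← Matrix.transpose_mul, hb])
      have h3 := congrArg Matrix.transpose h2
      rw [Matrix.transpose_mul, Matrix.transpose_mul, Matrix.transpose_transpose] at h3
      calc P * (Q * theta n x * Qᵀ) * Pᵀ = (P * (Q * theta n x)) * Qᵀ * Pᵀ := by
            simp only [Matrix.mul_assoc]
        _ = theta n x := by rw [h1, h3]
  have e := LinearEquiv.ofInjective Ψ hinj
  have h4 : Module.finrank ℂ (LinearMap.range Ψ) = d ^ 2 := by
    rw [← LinearEquiv.finrank_eq e, Module.finrank_matrix, Module.finrank_self, Fintype.card_fin]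
    ring
  rw [← hrange]
  exact h4

end Tens

theorem hilbert_eq (n : ℕ) : Module.finrank ℂ (sl2sl2Invariants n) =
    if n % 2 = 0 then (catalan (n / 2)) ^ 2 else 0 := by
  rw [finrank_inv]
  split_ifs with h
  · obtain ⟨k, rfl⟩ : ∃ k, n = 2 * k := ⟨n / 2, by omega⟩
    rw [finrank_slInv_even]
    congr 2
    omega
  · rw [finrank_slInv_odd n (by omega)]; rfl

/-- `F(t) = Σ_k C(2k,k)² t^{2k}` is transcendental over `ℚ(t)`; consequently the
Hilbert series `Σ_k C_k² t^{2k}` of the invariant ring of `SL(2)×SL(2)` acting on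
tensor powers of `ℂ²⊗ℂ²` (whose Hadamard product with the rational series
`Σ_k (k+1)² t^{2k}` is `F`) is not algebraic. -/
theorem centralBinom_sq_transcendental_and_invariant_hilbert_not_algebraic :
    ¬ IsAlgebraicPS (PowerSeries.mk fun m =>
        if m % 2 = 0 then ((Nat.centralBinom (m / 2) : ℚ)) ^ 2 else 0) ∧
      ¬ IsAlgebraicPS (PowerSeries.mk fun n =>
        (Module.finrank ℂ (sl2sl2Invariants n) : ℚ)) := by
  constructor
  · have h := transc_F
    have h2 : (fun m => ((bb m : ℕ) : ℚ) ^ 2) = fun m =>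
        if m % 2 = 0 then ((Nat.centralBinom (m / 2) : ℚ)) ^ 2 else 0 := by
      funext m
      by_cases hm : m % 2 = 0 <;> simp [bb, hm]
    rwa [h2] at h
  · have h := transc_H
    simp only [← hilbert_eq] at h
    exact h
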